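/- For any two trace class operators T_φ, T_π on a Hilbert space, the operator T := (|T_φ|² + |T_π|²)^{1/2} is trace class and satisfies ||T||₁ ≤ ||T_φ||₁ + ||T_π||₁. -/

import Mathlib

set_option synthInstance.maxHeartbeats 1000000
open scoped InnerProductSpace

/-- The trace of a (positive) operator `S`, computed along a Hilbert basis `e`
as `∑ᵢ Re ⟪eᵢ, S eᵢ⟫`. For positive `S` this is basis independent; for a
general operator the trace norm is `traceAlong e |S|`. -/
noncomputable def traceAlong {K : Type*} [NormedAddCommGroup K]
    [InnerProductSpace ℂ K] [CompleteSpace K]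
    (e : HilbertBasis ℕ ℂ K) (S : K →L[ℂ] K) : ℝ :=
  ∑' i, (⟪e i, S (e i)⟫_ℂ).re

/-- The absolute value `|S| = (S*S)^{1/2}` of a bounded operator. -/
noncomputable def absOp {K : Type*} [NormedAddCommGroup K]
    [InnerProductSpace ℂ K] [CompleteSpace K] (S : K →L[ℂ] K) : K →L[ℂ] K :=
  CFC.sqrt (ContinuousLinearMap.adjoint S * S)

open ContinuousLinearMap in
theorem aux_hs {K : Type*} [NormedAddCommGroup K] [InnerProductSpace ℂ K] [CompleteSpace K]
    (e : HilbertBasis ℕ ℂ K) (P V : K →L[ℂ] K) (hP : ∀ x y, ⟪P x, y⟫_ℂ = ⟪x, P y⟫_ℂ)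
    (hV : ∀ x, ‖V x‖ ≤ ‖x‖) (hs : Summable fun i => ‖P (e i)‖ ^ 2) (s : Finset ℕ) :
    ∑ i ∈ s, ‖P (V (e i))‖ ^ 2 ≤ ∑' i, ‖P (e i)‖ ^ 2 := by
  have hVn : ‖V‖ ≤ 1 := V.opNorm_le_bound zero_le_one (by simpa using hV)
  have hVa : ∀ x, ‖adjoint V x‖ ≤ ‖x‖ := fun x => by
    have h1 := (adjoint V).le_opNorm x
    have h2 : ‖adjoint V‖ = ‖V‖ := LinearIsometryEquiv.norm_map _ _
    rw [h2] at h1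
    nlinarith [norm_nonneg x]
  have key : ∀ i j, ‖⟪e j, P (V (e i))⟫_ℂ‖ ^ 2 = ‖⟪e i, adjoint V (P (e j))⟫_ℂ‖ ^ 2 := by
    intro i j
    rw [← hP, ← adjoint_inner_left, norm_inner_symm]
  have hsum : ∀ i, HasSum (fun j => ‖⟪e i, adjoint V (P (e j))⟫_ℂ‖ ^ 2) (‖P (V (e i))‖ ^ 2) := by
    intro i
    have h := e.hasSum_inner_mul_inner (P (V (e i))) (P (V (e i)))
    have h2 := Complex.hasSum_re h
    convert h2 using 1
    · funext j
      rw [← key, ← inner_conj_symm (P (V (e i))) (e j), Complex.conj_mul']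
      norm_cast
    · rw [inner_self_eq_norm_sq_to_K]; norm_cast
  have h3 := hasSum_sum (s := s) (fun i _ => hsum i)
  refine hasSum_le ?_ h3 hs.hasSum
  intro j
  refine (e.orthonormal.sum_inner_products_le _).trans ?_
  gcongr
  exact hVa _

theorem aux_sqrt {K : Type*} [NormedAddCommGroup K] [InnerProductSpace ℂ K] [CompleteSpace K]
    (S : K →L[ℂ] K) (hS : 0 ≤ S) :
    (∀ x y, ⟪CFC.sqrt S x, y⟫_ℂ = ⟪x, CFC.sqrt S y⟫_ℂ) ∧
    (∀ x, CFC.sqrt S (CFC.sqrt S x) = S x) ∧ (∀ x, 0 ≤ (⟪x, CFC.sqrt S x⟫_ℂ).re) := by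
  have h0 := CFC.sqrt_nonneg S
  have h1 := (ContinuousLinearMap.nonneg_iff_isPositive _).1 h0
  refine ⟨fun x y => h1.isSymmetric x y, fun x => ?_, fun x => ?_⟩
  · have := CFC.sqrt_mul_sqrt_self S hS
    exact congrArg (fun f => f x) this
  · exact h1.re_inner_nonneg_right x

theorem aux_tr {K : Type*} [NormedAddCommGroup K] [InnerProductSpace ℂ K] [CompleteSpace K]
    (e : HilbertBasis ℕ ℂ K) (A V : K →L[ℂ] K) (hA : 0 ≤ A)
    (hV : ∀ x, ‖V x‖ ≤ ‖x‖) (hs : Summable fun i => (⟪e i, A (e i)⟫_ℂ).re) (s : Finset ℕ) :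
    ∑ i ∈ s, (⟪V (e i), A (e i)⟫_ℂ).re ≤ ∑' i, (⟪e i, A (e i)⟫_ℂ).re := by
  obtain ⟨h1, h2, h3⟩ := aux_sqrt A hA
  set P := CFC.sqrt A
  have hn : ∀ i, (⟪e i, A (e i)⟫_ℂ).re = ‖P (e i)‖ ^ 2 := fun i => by
    rw [← h2, ← h1, inner_self_eq_norm_sq_to_K]; norm_cast
  simp only [hn] at hs ⊢
  have h4 := aux_hs e P V h1 hV hs s
  have h5 := hs.sum_le_tsum s (fun i _ => by positivity)
  have h6 : ∀ i ∈ s, (⟪V (e i), A (e i)⟫_ℂ).re ≤ (‖P (V (e i))‖ ^ 2 + ‖P (e i)‖ ^ 2) / 2 := by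
    intro i _
    rw [← h2, ← h1]
    have := (Complex.re_le_norm _).trans (norm_inner_le_norm (𝕜 := ℂ) (P (V (e i))) (P (e i)))
    nlinarith [sq_nonneg (‖P (V (e i))‖ - ‖P (e i)‖)]
  have h7 := Finset.sum_le_sum h6
  rw [← Finset.sum_div, Finset.sum_add_distrib] at h7
  linarith

theorem aux_main {K : Type*} [NormedAddCommGroup K] [InnerProductSpace ℂ K] [CompleteSpace K]
    (e : HilbertBasis ℕ ℂ K) (A B T : K →L[ℂ] K) (hA : 0 ≤ A) (hB : 0 ≤ B) (hT : 0 ≤ T)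
    (hsq : T * T = A * A + B * B)
    (hsA : Summable fun i => (⟪e i, A (e i)⟫_ℂ).re)
    (hsB : Summable fun i => (⟪e i, B (e i)⟫_ℂ).re) (s : Finset ℕ) (ε : ℝ) (hε : 0 < ε) :
    ∑ i ∈ s, (⟪e i, T (e i)⟫_ℂ).re ≤
      (∑' i, (⟪e i, A (e i)⟫_ℂ).re + ∑' i, (⟪e i, B (e i)⟫_ℂ).re) + ε * s.card := by
  have pA := (ContinuousLinearMap.nonneg_iff_isPositive _).1 hA
  have pB := (ContinuousLinearMap.nonneg_iff_isPositive _).1 hB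
  have pT := (ContinuousLinearMap.nonneg_iff_isPositive _).1 hT
  have sA : ∀ x y, ⟪A x, y⟫_ℂ = ⟪x, A y⟫_ℂ := fun x y => pA.isSymmetric x y
  have sB : ∀ x y, ⟪B x, y⟫_ℂ = ⟪x, B y⟫_ℂ := fun x y => pB.isSymmetric x y
  have sT : ∀ x y, ⟪T x, y⟫_ℂ = ⟪x, T y⟫_ℂ := fun x y => pT.isSymmetric x y
  have nT : ∀ x, 0 ≤ (⟪x, T x⟫_ℂ).re := fun x => pT.re_inner_nonneg_right x
  have hsq' : ∀ x, T (T x) = A (A x) + B (B x) := fun x => congrArg (fun f => f x) hsq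
  have hu : IsUnit (algebraMap ℝ (K →L[ℂ] K) (-ε) - T) := by
    by_contra h
    have h' : (-ε) ∈ spectrum ℝ T := h
    have := spectrum_nonneg_of_nonneg hT h'
    linarith
  obtain ⟨u, hu⟩ := hu
  set R : K →L[ℂ] K := -(↑u⁻¹ : K →L[ℂ] K) with hR
  have hux : ∀ x, (u : K →L[ℂ] K) x = -((ε : ℂ) • x + T x) := fun x => by
    rw [hu]
    simp [Algebra.algebraMap_eq_smul_one]
    abel
  have r1 : ∀ x, (ε : ℂ) • R x + T (R x) = x := fun x => by
    have : (u : K →L[ℂ] K) ((↑u⁻¹ : K →L[ℂ] K) x) = x :=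
      congrArg (fun f : K →L[ℂ] K => f x) u.mul_inv
    rw [hux] at this
    simp only [hR, ContinuousLinearMap.neg_apply, map_neg, smul_neg]
    rw [← neg_add, this]
  have nrm : ∀ y : K, ∀ S : K →L[ℂ] K, (∀ x y, ⟪S x, y⟫_ℂ = ⟪x, S y⟫_ℂ) →
      (⟪y, S (S y)⟫_ℂ).re = ‖S y‖ ^ 2 := fun y S hS => by
    rw [← hS, inner_self_eq_norm_sq_to_K]; norm_cast
  have hTR : ∀ x, ‖T (R x)‖ ^ 2 ≤ ‖x‖ ^ 2 := fun x => by
    conv_rhs => rw [← r1 x]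
    rw [norm_add_sq (𝕜 := ℂ), inner_smul_left]
    have h := nT (R x)
    have : 0 ≤ RCLike.re ((starRingEnd ℂ) (ε : ℂ) * ⟪R x, T (R x)⟫_ℂ) := by
      rw [Complex.conj_ofReal]
      show 0 ≤ Complex.re _
      rw [Complex.re_ofReal_mul]; positivity
    nlinarith [sq_nonneg ‖(ε : ℂ) • R x‖]
  have hab : ∀ y, ‖T y‖ ^ 2 = ‖A y‖ ^ 2 + ‖B y‖ ^ 2 := fun y => by
    rw [← nrm y T sT, hsq', inner_add_right, Complex.add_re, nrm y A sA, nrm y B sB]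
  have hAR : ∀ x, ‖(A * R) x‖ ≤ ‖x‖ := fun x => by
    refine abs_le_of_sq_le_sq' ?_ (norm_nonneg _) |>.2
    have := hab (R x); have := hTR x
    show ‖A (R x)‖ ^ 2 ≤ _
    nlinarith [sq_nonneg ‖B (R x)‖]
  have hBR : ∀ x, ‖(B * R) x‖ ≤ ‖x‖ := fun x => by
    refine abs_le_of_sq_le_sq' ?_ (norm_nonneg _) |>.2
    have := hab (R x); have := hTR x
    show ‖B (R x)‖ ^ 2 ≤ _
    nlinarith [sq_nonneg ‖A (R x)‖]
  have tA := aux_tr e A (A * R) hA hAR hsA s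
  have tB := aux_tr e B (B * R) hB hBR hsB s
  have pt : ∀ x, (⟪x, T x⟫_ℂ).re ≤
      ((⟪(A * R) x, A x⟫_ℂ).re + (⟪(B * R) x, B x⟫_ℂ).re) + ε * ‖x‖ ^ 2 := fun x => by
    have e1 : (⟪(A * R) x, A x⟫_ℂ).re + (⟪(B * R) x, B x⟫_ℂ).re = (⟪T (R x), T x⟫_ℂ).re := by
      show (⟪A (R x), A x⟫_ℂ).re + (⟪B (R x), B x⟫_ℂ).re = _
      rw [sA, sB, sT, hsq', inner_add_right, Complex.add_re]
    rw [e1]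
    -- T (R x) = x - ε R x
    have e2 : T (R x) = x - (ε : ℂ) • R x := by rw [eq_sub_iff_add_eq, add_comm]; exact r1 x
    have e3 : (⟪T (R x), T x⟫_ℂ).re = (⟪x, T x⟫_ℂ).re - ε * (⟪T (R x), x⟫_ℂ).re := by
      conv_lhs => rw [e2]
      rw [inner_sub_left, inner_smul_left, Complex.conj_ofReal, Complex.sub_re,
        Complex.re_ofReal_mul, sT]
    have e4 : (⟪T (R x), x⟫_ℂ).re ≤ ‖x‖ ^ 2 := by
      have a1 := (Complex.re_le_norm _).trans (norm_inner_le_norm (𝕜 := ℂ) (T (R x)) x)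
      have a2 : ‖T (R x)‖ ≤ ‖x‖ := abs_le_of_sq_le_sq' (hTR x) (norm_nonneg _) |>.2
      nlinarith [norm_nonneg x]
    rw [e3]
    nlinarith
  have h7 := Finset.sum_le_sum (s := s) (fun i _ => pt (e i))
  simp only [Finset.sum_add_distrib, e.orthonormal.1, one_pow, mul_one, Finset.sum_const,
    nsmul_eq_mul] at h7
  linarith

/-- For trace class operators `T_φ, T_π` on a separable Hilbert space, the
operator `T = (|T_φ|² + |T_π|²)^{1/2}` is trace class with
`‖T‖₁ ≤ ‖T_φ‖₁ + ‖T_π‖₁`. -/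
theorem sqrt_sum_sq_traceClass
    {K : Type*} [NormedAddCommGroup K] [InnerProductSpace ℂ K] [CompleteSpace K]
    (e : HilbertBasis ℕ ℂ K) (Tφ Tπ : K →L[ℂ] K)
    (hφ : Summable fun i => (⟪e i, absOp Tφ (e i)⟫_ℂ).re)
    (hπ : Summable fun i => (⟪e i, absOp Tπ (e i)⟫_ℂ).re)
    (T : K →L[ℂ] K)
    (hT : T = CFC.sqrt (ContinuousLinearMap.adjoint Tφ * Tφ +
        ContinuousLinearMap.adjoint Tπ * Tπ)) :
    (Summable fun i => (⟪e i, T (e i)⟫_ℂ).re) ∧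
      traceAlong e T ≤ traceAlong e (absOp Tφ) + traceAlong e (absOp Tπ) := by
  have nn : ∀ S : K →L[ℂ] K, 0 ≤ ContinuousLinearMap.adjoint S * S := fun S => star_mul_self_nonneg S
  have hsq : T * T = absOp Tφ * absOp Tφ + absOp Tπ * absOp Tπ := by
    rw [hT, CFC.sqrt_mul_sqrt_self _ (add_nonneg (nn _) (nn _))]
    unfold absOp
    rw [CFC.sqrt_mul_sqrt_self _ (nn _), CFC.sqrt_mul_sqrt_self _ (nn _)]
  have hT0 : 0 ≤ T := hT ▸ CFC.sqrt_nonneg _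
  have hb : ∀ s : Finset ℕ, ∑ i ∈ s, (⟪e i, T (e i)⟫_ℂ).re ≤
      traceAlong e (absOp Tφ) + traceAlong e (absOp Tπ) := by
    intro s
    refine le_of_forall_pos_le_add fun δ hδ => ?_
    have h := aux_main e (absOp Tφ) (absOp Tπ) T (CFC.sqrt_nonneg _) (CFC.sqrt_nonneg _) hT0 hsq
      hφ hπ s (δ / (s.card + 1)) (by positivity)
    refine h.trans ?_
    have : δ / (s.card + 1) * s.card ≤ δ := by
      rw [div_mul_eq_mul_div, div_le_iff₀ (by positivity)]
      nlinarith
    unfold traceAlong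
    linarith
  have h0 : ∀ i, 0 ≤ (⟪e i, T (e i)⟫_ℂ).re := fun i =>
    ((ContinuousLinearMap.nonneg_iff_isPositive _).1 hT0).re_inner_nonneg_right _
  have hs : Summable fun i => (⟪e i, T (e i)⟫_ℂ).re := summable_of_sum_le h0 hb
  exact ⟨hs, hs.tsum_le_of_sum_le hb⟩
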